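/- Let (w, i, j) ∈ Γ(W). The following are equivalent: (1) there exist v ∈ W and j′ ∈ I with (v, i, j′) ∈ Γ(W), (w, i, j) →_R (v, i, j′), and ℓ(v) < ℓ(w); (2) the element s_i w has more than one right descent. -/

import Mathlib

open CoxeterSystem

namespace NilpotencyIndices

variable {B : Type*} {W : Type*} [Group W] {M : CoxeterMatrix B}

/-- The set `Γ(W)` of triples `(w, i, j)` with `ℓ(sᵢ w sⱼ) = ℓ(w) - 2`
(stated as `ℓ(sᵢ w sⱼ) + 2 = ℓ(w)` to avoid truncated subtraction). -/
def InGamma (cs : CoxeterSystem M W) (x : W × B × B) : Prop :=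
  cs.length (cs.simple x.2.1 * x.1 * cs.simple x.2.2) + 2 = cs.length x.1

/-- The weak left (Bruhat) order: `v ≤_L w` iff `ℓ(v) + ℓ(w v⁻¹) = ℓ(w)`. -/
def WeakLeftLE (cs : CoxeterSystem M W) (v w : W) : Prop :=
  cs.length v + cs.length (w * v⁻¹) = cs.length w

/-- The weak right (Bruhat) order: `v ≤_R w` iff `ℓ(v) + ℓ(v⁻¹ w) = ℓ(w)`. -/
def WeakRightLE (cs : CoxeterSystem M W) (v w : W) : Prop :=
  cs.length v + cs.length (v⁻¹ * w) = cs.length w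

/-- `v(α_a) = α_b`: the group-theoretic condition `v sₐ v⁻¹ = s_b` and `ℓ(v sₐ) = ℓ(v) + 1`. -/
def MapsSimple (cs : CoxeterSystem M W) (v : W) (a b : B) : Prop :=
  v * cs.simple a * v⁻¹ = cs.simple b ∧ cs.length (v * cs.simple a) = cs.length v + 1

/-- `(w, i, j) →_L (u, i', j')` iff both triples are in `Γ(W)`, `u ≤_L w`, `j' = j`, and
`(w u⁻¹)(α_{i'}) = α_i`. -/
def RedL (cs : CoxeterSystem M W) (x y : W × B × B) : Prop :=
  InGamma cs x ∧ InGamma cs y ∧ WeakLeftLE cs y.1 x.1 ∧ y.2.2 = x.2.2 ∧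
    MapsSimple cs (x.1 * y.1⁻¹) y.2.1 x.2.1

/-- `(w, i, j) →_R (u, i', j')` iff both triples are in `Γ(W)`, `u ≤_R w`, `i' = i`, and
`(u⁻¹ w)(α_j) = α_{j'}`. -/
def RedR (cs : CoxeterSystem M W) (x y : W × B × B) : Prop :=
  InGamma cs x ∧ InGamma cs y ∧ WeakRightLE cs y.1 x.1 ∧ y.2.1 = x.2.1 ∧
    MapsSimple cs (y.1⁻¹ * x.1) x.2.2 y.2.2

/-- `→`: the reflexive-transitive closure of the union of `→_L` and `→_R`. -/
def Red (cs : CoxeterSystem M W) : (W × B × B) → (W × B × B) → Prop :=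
  Relation.ReflTransGen (fun x y => RedL cs x y ∨ RedR cs x y)

/-- `↔`: the equivalence relation generated by `→`. -/
def EquivRed (cs : CoxeterSystem M W) : (W × B × B) → (W × B × B) → Prop :=
  Relation.EqvGen (Red cs)

/-- The alternating word `a, b, a, b, …` with `n` letters, starting with `a`. -/
def altWord (a b : B) : ℕ → List B
  | 0 => []
  | n + 1 => a :: altWord b a n

/-- `w₀(a, b)`: the alternating product `sₐ s_b sₐ ⋯` with `M a b` factors, the longest element
of the subgroup generated by `sₐ` and `s_b` when `M a b` is finite (i.e. nonzero). -/
def w0 (cs : CoxeterSystem M W) (a b : B) : W :=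
  cs.wordProd (altWord a b (M a b))

/-- An element is bigrassmannian if it has exactly one left descent and exactly one
right descent. -/
def Bigrassmannian (cs : CoxeterSystem M W) (w : W) : Prop :=
  (∃! i, cs.IsLeftDescent w i) ∧ (∃! j, cs.IsRightDescent w j)

/-- The support of `w`: the set of indices appearing in some reduced word for `w`. -/
def Supp (cs : CoxeterSystem M W) (w : W) : Set B :=
  {i | ∃ l : List B, cs.IsReduced l ∧ cs.wordProd l = w ∧ i ∈ l}

/-- The relation `(w, i, j) →_{(k,L)} (u, i', j')`. -/
def RedkL (cs : CoxeterSystem M W) (k : B) (x y : W × B × B) : Prop :=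
  cs.length y.1 < cs.length x.1 ∧ RedR cs (x.1 * cs.simple k, x.2.1, x.2.2) x ∧
    RedL cs (x.1 * cs.simple k, x.2.1, x.2.2) y ∧ WeakLeftLE cs y.1 x.1

/-- The relation `(w, i, j) →_{(k,R)} (u, i', j')`. -/
def RedkR (cs : CoxeterSystem M W) (k : B) (x y : W × B × B) : Prop :=
  cs.length y.1 < cs.length x.1 ∧ RedL cs (cs.simple k * x.1, x.2.1, x.2.2) x ∧
    RedR cs (cs.simple k * x.1, x.2.1, x.2.2) y ∧ WeakRightLE cs y.1 x.1

/-- The orthogonality condition for a bigrassmannian element `w` with `D_L(w) = {i}` and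
`D_R(w) = {j}`. -/
def OrthCond (cs : CoxeterSystem M W) (w : W) (i j : B) : Prop :=
  (∀ a b : B, M a j = 2 → MapsSimple cs w a b → M b i = 2) ∧
  (∀ a b : B, M a i = 2 → MapsSimple cs w⁻¹ a b → M b j = 2)


/-! ### The geometric representation and distinctness of simple reflections -/

section Geometric

open Module Polynomial.Chebyshev

/-- The simple coroot `2⟨αᵢ, ·⟩` of the geometric representation, where
`⟨αᵢ, αⱼ⟩ = -cos (π / M i j)`. -/
noncomputable def simpleCoroot (M : CoxeterMatrix B) (i : B) : Dual ℝ (B →₀ ℝ) :=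
  Finsupp.linearCombination ℝ fun j => -2 * Real.cos (Real.pi / M i j)

theorem simpleCoroot_single (M : CoxeterMatrix B) (i j : B) :
    simpleCoroot M i (Finsupp.single j 1) = -2 * Real.cos (Real.pi / M i j) := by
  simp [simpleCoroot]

theorem simpleCoroot_single_self (M : CoxeterMatrix B) (i : B) :
    simpleCoroot M i (Finsupp.single i 1) = 2 := by
  simp [simpleCoroot_single]

/-- The reflection by which `sᵢ` acts in the geometric representation. -/
noncomputable def simpleReflection (M : CoxeterMatrix B) (i : B) :
    (B →₀ ℝ) ≃ₗ[ℝ] (B →₀ ℝ) :=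
  Module.reflection (simpleCoroot_single_self M i)

/-- Two reflections whose roots meet at the angle `π / m`, `m ≥ 3`, generate a rotation of
order dividing `m`. -/
theorem reflection_mul_reflection_pow_eq_one {V : Type*} [AddCommGroup V] [Module ℝ V]
    {x y : V} {f g : Dual ℝ V} (hf : f x = 2) (hg : g y = 2) {m : ℕ} (hm : 3 ≤ m)
    (hfy : f y = -2 * Real.cos (Real.pi / m)) (hgx : g x = -2 * Real.cos (Real.pi / m)) :
    (Module.reflection hf * Module.reflection hg) ^ m = 1 := by
  have hm0 : (0 : ℝ) < m := by positivity
  set θ : ℝ := 2 * Real.pi / m with hθ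
  have hmθ : m * θ = 2 * Real.pi := by rw [hθ]; field_simp
  have ht : 2 * Real.cos θ = f y * g x - 2 := by
    rw [hfy, hgx, hθ, mul_div_assoc, Real.cos_two_mul]; ring
  have hsin : Real.sin θ ≠ 0 := by
    refine (Real.sin_pos_of_pos_of_lt_pi (by positivity) ?_).ne'
    rw [hθ, div_lt_iff₀ hm0]
    have : (3 : ℝ) ≤ m := by exact_mod_cast hm
    nlinarith [Real.pi_pos]
  have hS (n : ℤ) : (S ℝ n).eval (2 * Real.cos θ) * Real.sin θ = Real.sin ((n + 1) * θ) :=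
    S_two_mul_real_cos θ n
  ext1 z
  rw [reflection_mul_reflection_pow_apply hf hg m z _ ht]
  obtain ⟨k, hk | hk⟩ := m.even_or_odd'
  · have h1 : ((m : ℤ) - 2) / 2 = k - 1 := by omega
    have h2 : ((m : ℤ) - 1) / 2 = k - 1 := by omega
    have h0 : (S ℝ ((k : ℤ) - 1)).eval (2 * Real.cos θ) = 0 := by
      refine (mul_eq_zero.mp ?_).resolve_right hsin
      have hkθ : (k : ℝ) * θ = Real.pi := by
        have : (m : ℝ) = 2 * k := by exact_mod_cast hk
        rw [this] at hmθ; linarith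
      rw [hS]
      push_cast
      rw [sub_add_cancel, hkθ, Real.sin_pi]
    simp [h1, h2, h0]
  · have h1 : ((m : ℤ) - 2) / 2 = k - 1 := by omega
    have h2 : ((m : ℤ) - 1) / 2 = k := by omega
    have h3 : ((m : ℤ) - 3) / 2 = k - 1 := by omega
    have h4 : (m : ℤ) / 2 = k := by omega
    have h0 : (S ℝ (k : ℤ)).eval (2 * Real.cos θ) +
        (S ℝ ((k : ℤ) - 1)).eval (2 * Real.cos θ) = 0 := by
      refine (mul_eq_zero.mp ?_).resolve_right hsin
      have hkθ : ((k : ℝ) + 1) * θ = 2 * Real.pi - k * θ := by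
        have : (m : ℝ) = 2 * k + 1 := by exact_mod_cast hk
        rw [this] at hmθ; linarith
      rw [add_mul, hS, hS]
      push_cast
      rw [sub_add_cancel, hkθ, Real.sin_two_pi_sub, neg_add_cancel]
    simp [h1, h2, h3, h4, h0]

theorem isLiftable_simpleReflection (M : CoxeterMatrix B) :
    M.IsLiftable (simpleReflection M) := by
  intro i i'
  have hsymm : (M i' i : ℝ) = M i i' := by rw [M.symmetric]
  rcases eq_or_ne i i' with rfl | hne
  · rw [M.diagonal, pow_one]
    ext1 z
    exact involutive_reflection (simpleCoroot_single_self M i) z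
  obtain h0 | h1 | h2 | h3 : M i i' = 0 ∨ M i i' = 1 ∨ M i i' = 2 ∨ 3 ≤ M i i' := by omega
  · rw [h0, pow_zero]
  · exact absurd h1 (M.off_diagonal i i' hne)
  · have hi := simpleCoroot_single M i i'
    have hi' := simpleCoroot_single M i' i
    rw [hsymm] at hi'
    simp only [h2, Nat.cast_ofNat, Real.cos_pi_div_two, mul_zero] at hi hi'
    rw [h2, pow_two]
    ext1 z
    simp only [simpleReflection, LinearEquiv.mul_apply, reflection_apply, map_sub, map_smul, hi,
      hi', simpleCoroot_single_self, LinearEquiv.coe_one, id_eq]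
    module
  · exact reflection_mul_reflection_pow_eq_one _ _ h3 (simpleCoroot_single M i i')
      (by rw [simpleCoroot_single, hsymm])

theorem simple_injective (cs : CoxeterSystem M W) : Function.Injective cs.simple := by
  intro i j hij
  by_contra hne
  have h := congrArg (cs.lift ⟨_, isLiftable_simpleReflection M⟩) hij
  rw [cs.lift_apply_simple, cs.lift_apply_simple] at h
  have h' := DFunLike.congr_fun (LinearEquiv.congr_fun h (Finsupp.single i 1)) i
  simp [simpleReflection, reflection_apply, Finsupp.single_eq_of_ne hne] at h'
  norm_num at h'

end Geometric

/-! ### Parity of inversions and the exchange property -/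

section InversionParity

open scoped Classical in
/-- The map `(t, e) ↦ (sᵢ t sᵢ, e + [t = sᵢ])`, by which `sᵢ` acts on `W × ℤ/2`. -/
noncomputable def parityStep (cs : CoxeterSystem M W) (i : B) : Function.End (W × ZMod 2) :=
  fun p => (cs.simple i * p.1 * cs.simple i, p.2 + if p.1 = cs.simple i then 1 else 0)

open scoped Classical in
theorem parityStep_mul_pow_apply (cs : CoxeterSystem M W) (i i' : B) (n : ℕ) (t : W)
    (e : ZMod 2) :
    ((parityStep cs i * parityStep cs i') ^ n) (t, e) =
      ((cs.simple i * cs.simple i') ^ n * t * ((cs.simple i * cs.simple i') ^ n)⁻¹,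
        e + ∑ k ∈ Finset.range (2 * n),
          if t = ((cs.simple i * cs.simple i') ^ k)⁻¹ * cs.simple i' then 1 else 0) := by
  induction n with
  | zero => simp; rfl
  | succ n ih =>
    rw [pow_succ']
    change (parityStep cs i) (parityStep cs i' (((parityStep cs i * parityStep cs i') ^ n) (t, e)))
      = _
    rw [ih]
    set p := cs.simple i * cs.simple i' with hp
    have hpi : p⁻¹ = cs.simple i' * cs.simple i := by simp [hp]
    have hconj (k : ℕ) : cs.simple i' * p ^ k * cs.simple i' = (p ^ k)⁻¹ := by
      induction k with
      | zero => simp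
      | succ k ihk =>
        calc cs.simple i' * p ^ (k + 1) * cs.simple i'
            = (cs.simple i' * p ^ k * cs.simple i') * (cs.simple i' * p * cs.simple i') := by
              rw [pow_succ]; simp [mul_assoc]
          _ = (p ^ (k + 1))⁻¹ := by
              rw [ihk, pow_succ', mul_inv_rev]
              congr 1
              simp [hp, mul_assoc]
    have hconj' (k : ℕ) : cs.simple i' * p ^ k = (p ^ k)⁻¹ * cs.simple i' := by
      rw [← hconj k]; simp [mul_assoc]
    have h1 : (p ^ n * t * (p ^ n)⁻¹ = cs.simple i') ↔
        t = (p ^ (2 * n))⁻¹ * cs.simple i' := by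
      rw [mul_inv_eq_iff_eq_mul, ← eq_inv_mul_iff_mul_eq, hconj', two_mul, pow_add, mul_inv_rev,
        mul_assoc]
    have h2 : (cs.simple i' * (p ^ n * t * (p ^ n)⁻¹) * cs.simple i' = cs.simple i) ↔
        t = (p ^ (2 * n + 1))⁻¹ * cs.simple i' := by
      have : (cs.simple i' * (p ^ n * t * (p ^ n)⁻¹) * cs.simple i' = cs.simple i) ↔
          p ^ n * t * (p ^ n)⁻¹ = p⁻¹ * cs.simple i' := by
        rw [hpi]
        constructor
        · intro h; rw [← h]; simp [mul_assoc]
        · intro h; rw [h]; simp [mul_assoc]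
      rw [this, mul_inv_eq_iff_eq_mul, ← eq_inv_mul_iff_mul_eq, mul_assoc, hconj']
      have h3 : p ^ (2 * n + 1) = p ^ n * p * p ^ n := by
        rw [← pow_succ, ← pow_add]; congr 1; omega
      rw [h3]
      simp [mul_assoc]
    simp only [parityStep, h1, h2]
    refine Prod.ext ?_ ?_
    · change cs.simple i * (cs.simple i' * (p ^ n * t * (p ^ n)⁻¹) * cs.simple i') * cs.simple i = _
      rw [pow_succ', mul_inv_rev, hpi]
      nth_rw 3 [hp]
      simp only [mul_assoc]
    · rw [show 2 * (n + 1) = 2 * n + 1 + 1 by ring, Finset.sum_range_succ, Finset.sum_range_succ]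
      simp only [add_assoc]

theorem isLiftable_parityStep (cs : CoxeterSystem M W) : M.IsLiftable (parityStep cs) := by
  classical
  intro i i'
  funext ⟨t, e⟩
  rw [parityStep_mul_pow_apply, two_mul, Finset.sum_range_add]
  simp only [pow_add, cs.simple_mul_simple_pow, one_mul, inv_one, mul_one, CharTwo.add_self_eq_zero,
    add_zero]
  rfl

/-- The parity of the number of times `t` occurs in the right inversion sequence of a word
for `w`. -/
noncomputable def inversionParity (cs : CoxeterSystem M W) (w t : W) : ZMod 2 :=
  (cs.lift ⟨_, isLiftable_parityStep cs⟩ w (t, 0)).2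

theorem lift_parityStep_apply (cs : CoxeterSystem M W) (w t : W) (e : ZMod 2) :
    cs.lift ⟨_, isLiftable_parityStep cs⟩ w (t, e) =
      (w * t * w⁻¹, e + inversionParity cs w t) := by
  induction w using cs.simple_induction_left generalizing e with
  | one =>
    rw [inversionParity, map_one]
    change (t, e) = (1 * t * 1⁻¹, e + 0)
    simp
  | mul_simple_left w i ih =>
    have key (e' : ZMod 2) : cs.lift ⟨_, isLiftable_parityStep cs⟩ (cs.simple i * w) (t, e') =
        parityStep cs i (w * t * w⁻¹, e' + inversionParity cs w t) := by
      rw [← ih, map_mul, cs.lift_apply_simple]; rfl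
    rw [inversionParity, key, key]
    simp [parityStep, mul_assoc, add_assoc]

theorem inversionParity_mul (cs : CoxeterSystem M W) (y z t : W) :
    inversionParity cs (y * z) t =
      inversionParity cs z t + inversionParity cs y (z * t * z⁻¹) := by
  have h : cs.lift ⟨_, isLiftable_parityStep cs⟩ (y * z) (t, 0) =
      cs.lift ⟨_, isLiftable_parityStep cs⟩ y
        (cs.lift ⟨_, isLiftable_parityStep cs⟩ z (t, 0)) := by
    rw [map_mul]; rfl
  rw [inversionParity, h, lift_parityStep_apply, lift_parityStep_apply, zero_add]

open scoped Classical in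
theorem inversionParity_simple (cs : CoxeterSystem M W) (i : B) (t : W) :
    inversionParity cs (cs.simple i) t = if t = cs.simple i then 1 else 0 := by
  rw [inversionParity, cs.lift_apply_simple]
  simp [parityStep]

theorem inversionParity_one (cs : CoxeterSystem M W) (t : W) : inversionParity cs 1 t = 0 := by
  rw [inversionParity, map_one]; rfl

theorem mem_rightInvSeq_of_inversionParity_ne_zero (cs : CoxeterSystem M W) {ω : List B} {t : W}
    (h : inversionParity cs (cs.wordProd ω) t ≠ 0) : t ∈ cs.rightInvSeq ω := by
  classical
  induction ω with
  | nil => simp [inversionParity_one] at h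
  | cons i ω ih =>
    rw [cs.wordProd_cons, inversionParity_mul, inversionParity_simple] at h
    rw [rightInvSeq, List.mem_cons]
    by_cases ht : cs.wordProd ω * t * (cs.wordProd ω)⁻¹ = cs.simple i
    · left
      rw [← ht]
      group
    · right
      rw [if_neg ht, add_zero] at h
      exact ih h

theorem length_mul_lt_of_inversionParity_ne_zero (cs : CoxeterSystem M W) {w t : W}
    (h : inversionParity cs w t ≠ 0) : cs.length (w * t) < cs.length w := by
  obtain ⟨ω, hω, rfl⟩ := cs.exists_isReduced w
  exact (cs.isRightInversion_of_mem_rightInvSeq hω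
    (mem_rightInvSeq_of_inversionParity_ne_zero cs h)).2

theorem inversionParity_ne_zero_of_isRightDescent (cs : CoxeterSystem M W) {w : W} {i : B}
    (h : cs.IsRightDescent w i) : inversionParity cs w (cs.simple i) ≠ 0 := by
  intro h0
  have h1 : inversionParity cs (w * cs.simple i) (cs.simple i) ≠ 0 := by
    rw [inversionParity_mul, inversionParity_simple]
    simp [h0]
  have h2 := length_mul_lt_of_inversionParity_ne_zero cs h1
  rw [cs.simple_mul_simple_cancel_right] at h2
  exact lt_asymm h h2

end InversionParity

/-! ### Two right descents and dihedral factors -/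

section Dihedral

theorem inversionParity_alternatingWord_eq_zero (cs : CoxeterSystem M W) (a b : B) (n : ℕ) (t : W)
    (ht : ∀ k < n, t ≠ cs.simple b * (cs.simple a * cs.simple b) ^ k) :
    inversionParity cs (cs.wordProd (alternatingWord a b n)) t = 0 := by
  classical
  induction n generalizing a b t with
  | zero => simp [alternatingWord, inversionParity_one]
  | succ n ih =>
    have h0 : t ≠ cs.simple b := by simpa using ht 0 n.succ_pos
    rw [alternatingWord_succ, cs.wordProd_concat, inversionParity_mul, inversionParity_simple,
      if_neg h0, zero_add]
    refine ih b a _ fun k hk h => ht (k + 1) (Nat.succ_lt_succ hk) ?_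
    rw [mul_inv_eq_iff_eq_mul, ← eq_inv_mul_iff_mul_eq, cs.inv_simple] at h
    have hconj : SemiconjBy (cs.simple b) (cs.simple a * cs.simple b)
        (cs.simple b * cs.simple a) := by simp [SemiconjBy, mul_assoc]
    rw [h, pow_succ', mul_assoc (cs.simple a), ← (hconj.pow_right k).eq, ← mul_assoc (cs.simple a)]

theorem length_wordProd_alternatingWord_le (cs : CoxeterSystem M W) (a b : B) (n : ℕ) :
    cs.length (cs.wordProd (alternatingWord a b n)) ≤ n := by
  simpa using cs.length_wordProd_le (alternatingWord a b n)

/-- If `a` and `b` are right descents of `u`, then `u` ends in every alternating word in `a`, `b`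
whose length does not exceed the order of `s_a s_b`. -/
theorem length_mul_inv_alternatingWord (cs : CoxeterSystem M W) {u : W} {a b : B}
    (ha : cs.IsRightDescent u a) (hb : cs.IsRightDescent u b) (n : ℕ)
    (hn : ∀ k, 0 < k → k < n → (cs.simple a * cs.simple b) ^ k ≠ 1) :
    cs.length (u * (cs.wordProd (alternatingWord a b n))⁻¹) + n = cs.length u := by
  induction n generalizing a b with
  | zero => simp [alternatingWord]
  | succ n ih =>
    have hn' (k : ℕ) (hk : 0 < k) (hkn : k ≤ n) : (cs.simple b * cs.simple a) ^ k ≠ 1 := by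
      intro h
      apply hn k hk (by omega)
      have := congrArg (·⁻¹) h
      simpa [← inv_pow] using this
    have hy := ih hb ha fun k hk hkn => hn' k hk hkn.le
    set z := cs.wordProd (alternatingWord b a n) with hz
    have hz0 : inversionParity cs z (cs.simple b) = 0 := by
      refine inversionParity_alternatingWord_eq_zero cs b a n _ fun k hk h => ?_
      apply hn' (k + 1) k.succ_pos hk
      rw [pow_succ', mul_assoc, ← h, cs.simple_mul_simple_self]
    have hub := inversionParity_ne_zero_of_isRightDescent cs hb
    rw [← inv_mul_cancel_right u z, inversionParity_mul, hz0, zero_add] at hub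
    have hlt := length_mul_lt_of_inversionParity_ne_zero cs hub
    have heq : u * z⁻¹ * (z * cs.simple b * z⁻¹) =
        u * (cs.wordProd (alternatingWord a b (n + 1)))⁻¹ := by
      rw [alternatingWord_succ, cs.wordProd_concat, ← hz]
      simp [mul_assoc]
    rw [heq] at hlt
    have h1 := cs.length_le_length_mul_add_right u
      (cs.wordProd (alternatingWord a b (n + 1)))⁻¹
    rw [cs.length_inv] at h1
    have h2 := length_wordProd_alternatingWord_le cs a b (n + 1)
    omega

theorem wordProd_alternatingWord_comm (cs : CoxeterSystem M W) {a b : B} {m : ℕ}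
    (hm : (cs.simple a * cs.simple b) ^ m = 1) :
    cs.wordProd (alternatingWord a b m) = cs.wordProd (alternatingWord b a m) := by
  have hinv : cs.simple b * cs.simple a = (cs.simple a * cs.simple b)⁻¹ := by simp
  rw [cs.prod_alternatingWord_eq_mul_pow, cs.prod_alternatingWord_eq_mul_pow, hinv, inv_pow]
  obtain ⟨k, rfl | rfl⟩ := m.even_or_odd'
  · rw [two_mul, pow_add] at hm
    simpa using mul_eq_one_iff_eq_inv.mp hm
  · have hk : (2 * k + 1) / 2 = k := by omega
    rw [hk, if_neg (by simp), if_neg (by simp), eq_mul_inv_iff_mul_eq,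
      ← mul_right_inj (cs.simple a), cs.simple_mul_simple_self, ← hm]
    rw [pow_succ', two_mul, pow_add]
    simp only [mul_assoc]

/-- An element with two distinct right descents `a`, `b` ends in the longest element of the
dihedral subgroup generated by `s_a` and `s_b`. -/
theorem exists_dihedral_factor (cs : CoxeterSystem M W) {u : W} {a b : B} (hab : a ≠ b)
    (ha : cs.IsRightDescent u a) (hb : cs.IsRightDescent u b) :
    ∃ (x : W) (c : B), 0 < cs.length x ∧ MapsSimple cs x a c ∧
      cs.length (u * (x * cs.simple a)⁻¹) + cs.length x + 1 = cs.length u := by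
  set p := cs.simple a * cs.simple b with hp
  have hfin : 0 < orderOf p := by
    rw [orderOf_pos_iff, isOfFinOrder_iff_pow_eq_one]
    by_contra! hinf
    have := length_mul_inv_alternatingWord cs ha hb (cs.length u + 1) fun k hk _ => hinf k hk
    omega
  have hne : orderOf p ≠ 1 := by
    rw [Ne, orderOf_eq_one_iff, hp, mul_eq_one_iff_eq_inv, cs.inv_simple]
    exact (simple_injective cs).ne hab
  obtain ⟨n, hn⟩ : ∃ n, orderOf p = n + 1 := ⟨orderOf p - 1, by omega⟩
  have hlen := length_mul_inv_alternatingWord cs ha hb (n + 1)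
    fun k hk hkn => pow_ne_one_of_lt_orderOf hk.ne' (hn ▸ hkn)
  have hcomm := wordProd_alternatingWord_comm cs (hn ▸ pow_orderOf_eq_one p : p ^ (n + 1) = 1)
  have hxa : cs.wordProd (alternatingWord a b n) * cs.simple a =
      cs.wordProd (alternatingWord a b (n + 1)) := by
    rw [hcomm, alternatingWord_succ, cs.wordProd_concat]
  have hcx : cs.wordProd (alternatingWord a b (n + 1)) =
      cs.simple (if Even n then b else a) * cs.wordProd (alternatingWord a b n) := by
    rw [alternatingWord_succ', cs.wordProd_cons]
  have h1 := cs.length_le_length_mul_add_right u (cs.wordProd (alternatingWord a b (n + 1)))⁻¹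
  rw [cs.length_inv] at h1
  have h2 := length_wordProd_alternatingWord_le cs a b n
  have h3 := cs.length_mul_le (cs.wordProd (alternatingWord a b n)) (cs.simple a)
  rw [cs.length_simple, hxa] at h3
  refine ⟨cs.wordProd (alternatingWord a b n), if Even n then b else a, by omega, ⟨?_, ?_⟩, ?_⟩
  · rw [hxa, hcx, mul_inv_cancel_right]
  · rw [hxa]; omega
  · rw [hxa]; omega

end Dihedral

/-- A length-decreasing right reduction from `(w, i, j)` exists iff `sᵢ w`
has more than one right descent. -/
theorem exists_length_lt_redR_iff (cs : CoxeterSystem M W) (w : W) (i j : B)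
    (h : InGamma cs (w, i, j)) :
    (∃ (v : W) (j' : B), InGamma cs (v, i, j') ∧ RedR cs (w, i, j) (v, i, j') ∧
        cs.length v < cs.length w) ↔
      (∃ a b : B, a ≠ b ∧ cs.IsRightDescent (cs.simple i * w) a ∧
        cs.IsRightDescent (cs.simple i * w) b) := by
  have hj : cs.IsRightDescent (cs.simple i * w) j := by
    have h1 := cs.length_simple_mul w i
    have h2 := cs.length_mul_simple (cs.simple i * w) j
    simp only [InGamma] at h
    unfold IsRightDescent
    omega
  have hw : cs.length (cs.simple i * w) + 1 = cs.length w := by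
    have h1 := cs.length_simple_mul w i
    have h2 := cs.length_mul_simple (cs.simple i * w) j
    simp only [InGamma] at h
    omega
  constructor
  · rintro ⟨v, j', hv, ⟨-, -, hle, -, -, hlen⟩, hlt⟩
    simp only [WeakRightLE] at hle
    simp only at hlen
    set x := v⁻¹ * w with hx
    have hwx : w = v * x := by simp [hx]
    have hx1 : x ≠ 1 := by
      intro h1
      rw [h1, cs.length_one] at hle
      omega
    obtain ⟨b, hb⟩ := cs.exists_rightDescent_of_ne_one hx1
    have hbx : cs.length (x * cs.simple b) < cs.length x := hb
    refine ⟨j, b, ?_, hj, ?_⟩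
    · rintro rfl
      omega
    · have h1 := cs.length_simple_mul v i
      have h2 := cs.length_mul_simple (cs.simple i * v) j'
      simp only [InGamma] at hv
      have h3 := cs.length_mul_le (cs.simple i * v) (x * cs.simple b)
      have h4 : cs.simple i * w * cs.simple b = cs.simple i * v * (x * cs.simple b) := by
        rw [hwx]; simp only [mul_assoc]
      unfold IsRightDescent
      rw [h4]
      omega
  · rintro ⟨a, b, hab, ha, hb⟩
    obtain ⟨k, hk, hjk⟩ : ∃ k, cs.IsRightDescent (cs.simple i * w) k ∧ j ≠ k := by
      by_cases hja : j = a
      · exact ⟨b, hb, hja ▸ hab⟩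
      · exact ⟨a, ha, hja⟩
    obtain ⟨x, c, hx, hmap, hlen⟩ := exists_dihedral_factor cs hjk hj hk
    have hc : x * cs.simple j = cs.simple c * x := mul_inv_eq_iff_eq_mul.mp hmap.1
    have hred : cs.simple i * (w * x⁻¹) * cs.simple c =
        cs.simple i * w * (x * cs.simple j)⁻¹ := by
      rw [hc]; simp [mul_assoc]
    have hvx : (w * x⁻¹)⁻¹ * w = x := by simp
    have h1 := cs.length_simple_mul (w * x⁻¹) i
    have h2 := cs.length_mul_simple (cs.simple i * (w * x⁻¹)) c
    have h3 := cs.length_le_length_mul_add_right w x⁻¹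
    rw [cs.length_inv] at h3
    rw [← hred] at hlen
    have hv : InGamma cs (w * x⁻¹, i, c) := by
      simp only [InGamma]
      omega
    refine ⟨w * x⁻¹, c, hv, ⟨h, hv, ?_, rfl, ?_⟩, ?_⟩
    · simp only [WeakRightLE, hvx]
      omega
    · simpa only [hvx] using hmap
    · omega

end NilpotencyIndices
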